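/- arXiv:1204.2954 — 2 statements merged into one kernel-verified Lean document; each statement's English description precedes it below -/
import Mathlib

section
/- Let X ⊆ ℝ be an interval containing more than one point and let D ⊆ X be a subset that is open in X such that X \ D has empty dense-in-itself kernel (every nonempty subset S ⊆ X \ D has a point isolated in S). Let λ : ℝ → ℝ be continuous on X with λ(x) ≥ 0 for all x ∈ X, and suppose that at every point x ∈ D with λ(x) ≠ 0 the function λ is differentiable with derivative 0. Then λ is constant on X. -/
open Filter

open scoped Topology

/-- In a second countable space, a set whose nonempty subsets all have an isolated point
is countable. -/
theorem Set.countable_of_forall_subset_exists_not_accPt {α : Type*} [TopologicalSpace α]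
    [SecondCountableTopology α] {C : Set α}
    (h : ∀ S ⊆ C, S.Nonempty → ∃ x ∈ S, ¬ AccPt x (𝓟 S)) : C.Countable := by
  set S : Set α := {x ∈ C | ∀ U ∈ 𝓝 x, ¬ (U ∩ C).Countable} with hS
  have hCS : (C \ S).Countable := by
    have hU : ∀ x, ∃ U : Set α, x ∈ C \ S → U ∈ 𝓝 x ∧ (U ∩ C).Countable := by
      intro x
      by_cases hx : x ∈ C \ S
      · have hx2 : ¬ ∀ U ∈ 𝓝 x, ¬ (U ∩ C).Countable := fun H => hx.2 ⟨hx.1, H⟩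
        push Not at hx2
        obtain ⟨U, hU⟩ := hx2
        exact ⟨U, fun _ => hU⟩
      · exact ⟨∅, fun H => absurd H hx⟩
    choose U hU using hU
    obtain ⟨t, hts, htc, hcov⟩ := TopologicalSpace.countable_cover_nhdsWithin
      (s := C \ S) (f := U) fun x hx => mem_nhdsWithin_of_mem_nhds (hU x hx).1
    refine (htc.biUnion fun x hx => (hU x (hts hx)).2).mono fun y hy => ?_
    obtain ⟨x, hx, hyx⟩ := Set.mem_iUnion₂.1 (hcov hy)
    exact Set.mem_iUnion₂.2 ⟨x, hx, hyx, hy.1⟩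
  rcases S.eq_empty_or_nonempty with hne | hne
  · simpa [hne] using hCS
  obtain ⟨x, hx, hacc⟩ := h S (fun x hx => hx.1) hne
  refine absurd (accPt_iff_nhds.2 fun U hU => ?_) hacc
  by_contra! H
  refine hx.2 U hU ((hCS.union (Set.countable_singleton x)).mono fun y hy => ?_)
  by_cases hyS : y ∈ S
  · exact Or.inr (H y ⟨hy.1, hyS⟩)
  · exact Or.inl ⟨hy.2, hyS⟩

/-- Truncating a function from below preserves a vanishing derivative. -/
theorem HasDerivAt.max_const_of_deriv_zero {f : ℝ → ℝ} {x : ℝ} (hf : HasDerivAt f 0 x) (c : ℝ) :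
    HasDerivAt (fun t => max (f t) c) 0 x := by
  rw [hasDerivAt_iff_isLittleO] at hf ⊢
  refine (Asymptotics.IsBigO.of_bound 1 (Eventually.of_forall fun t => ?_)).trans_isLittleO hf
  simpa using abs_max_sub_max_le_abs (f t) (f x) c

/-- A continuous function on `[a, b]` whose derivative vanishes off a countable set takes
equal values at the endpoints. -/
theorem eq_of_hasDerivAt_zero_off_countable {f : ℝ → ℝ} {s : Set ℝ} {a b : ℝ} (hab : a ≤ b)
    (hs : s.Countable) (hc : ContinuousOn f (Set.Icc a b))
    (hd : ∀ x ∈ Set.Ioo a b \ s, HasDerivAt f 0 x) : f a = f b := by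
  have h := MeasureTheory.integral_eq_of_hasDerivAt_off_countable_of_le f (fun _ => (0 : ℝ))
    hab hs hc hd (by simp)
  simp only [intervalIntegral.integral_zero] at h
  linarith

/-- Step 1 in the proof that a non-null weakened Mannheim curve is a Frenet–Mannheim
curve: if `X ⊆ ℝ` is an interval with more than one point, `D ⊆ X` is open in `X`,
`X \ D` has empty dense-in-itself kernel, `λ` is continuous and nonnegative on `X`,
and `λ` has vanishing derivative at every point of `D` where it is nonzero,
then `λ` is constant on `X`. -/
theorem lambda_constant_of_empty_denseInItself_kernel
    (X D : Set ℝ) (hX : X.OrdConnected) (hX2 : X.Nontrivial)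
    (hDX : D ⊆ X) (hDopen : ∃ U : Set ℝ, IsOpen U ∧ D = U ∩ X)
    (hkernel : ∀ S : Set ℝ, S ⊆ X \ D → S.Nonempty → ∃ x ∈ S, ¬ AccPt x (𝓟 S))
    (lam : ℝ → ℝ) (hcont : ContinuousOn lam X) (hnonneg : ∀ x ∈ X, 0 ≤ lam x)
    (hderiv : ∀ x ∈ D, lam x ≠ 0 → HasDerivAt lam 0 x) :
    ∀ x ∈ X, ∀ y ∈ X, lam x = lam y := by
  have hC : (X \ D).Countable := Set.countable_of_forall_subset_exists_not_accPt hkernel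
  have htrunc : ∀ c > 0, ∀ x ∈ X, ∀ y ∈ X, x ≤ y → max (lam x) c = max (lam y) c := by
    intro c hc x hx y hy hxy
    have hsub : Set.Icc x y ⊆ X := hX.out hx hy
    refine eq_of_hasDerivAt_zero_off_countable (f := fun t => max (lam t) c) hxy hC
      ((hcont.mono hsub).sup continuousOn_const) fun z hz => ?_
    have hzX : z ∈ X := hsub (Set.Ioo_subset_Icc_self hz.1)
    have hzD : z ∈ D := by_contra fun h => hz.2 ⟨hzX, h⟩
    by_cases h0 : lam z = 0
    · have hcz : ContinuousAt lam z :=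
        (hcont.mono hsub).continuousAt (Icc_mem_nhds hz.1.1 hz.1.2)
      refine (hasDerivAt_const z c).congr_of_eventuallyEq ?_
      filter_upwards [hcz.eventually_lt continuousAt_const (h0.trans_lt hc)] with t ht
      exact max_eq_right ht.le
    · exact (hderiv z hzD h0).max_const_of_deriv_zero c
  have hle : ∀ x ∈ X, ∀ y ∈ X, lam x ≤ lam y := by
    intro x hx y hy
    by_contra! hlt
    have hy0 := hnonneg y hy
    have heq : max (lam x) ((lam x + lam y) / 2) = max (lam y) ((lam x + lam y) / 2) := by
      rcases le_total x y with h | h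
      · exact htrunc _ (by linarith) x hx y hy h
      · exact (htrunc _ (by linarith) y hy x hx h).symm
    rw [max_eq_left (by linarith), max_eq_right (by linarith)] at heq
    linarith
  exact fun x hx y hy => (hle x hx y hy).antisymm (hle y hy x hx)
end

section
/- Let (α, β, σ, λ, μ) with Frenet apparatuses (T, N, B, κ, τ; ε₁, ε₂) and (T̃, Ñ, B̃, κ̃, τ̃; ε̃₁, ε̃₂) form a non-null Mannheim pair satisfying the hyperbolic-angle hypothesis with angle function φ. Then for all s ∈ ℝ: σ′(s) = cosh(φ(s)) and σ′(s)·λ(σ(s))·ε̃₁·τ̃(σ(s)) = sinh(φ(s)). -/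
noncomputable def mink (x y : Fin 3 → ℝ) : ℝ :=
  -(x 0 * y 0) + x 1 * y 1 + x 2 * y 2

/-- A Frenet apparatus with signs `(ε₁, ε₂)` for a smooth curve `γ : ℝ → ℝ³`
in Minkowski 3-space. -/
structure FrenetApparatus (γ T N B : ℝ → Fin 3 → ℝ) (κ τ : ℝ → ℝ) (ε₁ ε₂ : ℝ) : Prop where
  smooth_curve : ContDiff ℝ (⊤ : ℕ∞) γ
  smooth_T : ContDiff ℝ (⊤ : ℕ∞) T
  smooth_N : ContDiff ℝ (⊤ : ℕ∞) N
  smooth_B : ContDiff ℝ (⊤ : ℕ∞) B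
  smooth_curv : ContDiff ℝ (⊤ : ℕ∞) κ
  smooth_tors : ContDiff ℝ (⊤ : ℕ∞) τ
  sign1 : ε₁ = 1 ∨ ε₁ = -1
  sign2 : ε₂ = 1 ∨ ε₂ = -1
  tangent : ∀ s, T s = deriv γ s
  inner_TT : ∀ s, mink (T s) (T s) = ε₁
  inner_NN : ∀ s, mink (N s) (N s) = ε₂
  inner_BB : ∀ s, mink (B s) (B s) = -ε₂
  inner_TN : ∀ s, mink (T s) (N s) = 0
  inner_TB : ∀ s, mink (T s) (B s) = 0
  inner_NB : ∀ s, mink (N s) (B s) = 0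
  frenet_T : ∀ s, deriv T s = κ s • N s
  frenet_N : ∀ s, deriv N s = (-(ε₁ * ε₂) * κ s) • T s + τ s • B s
  frenet_B : ∀ s, deriv B s = (ε₁ * τ s) • N s

/-- A non-null Mannheim pair `(α, β, σ, λ, μ)` together with Frenet apparatuses
`(T, N, B, κ, τ; ε₁, ε₂)` of `α` and `(T', N', B', κ', τ'; ε₁', ε₂')` of `β`. -/
structure MannheimPair (α β T N B : ℝ → Fin 3 → ℝ) (κ τ : ℝ → ℝ) (ε₁ ε₂ : ℝ)
    (T' N' B' : ℝ → Fin 3 → ℝ) (κ' τ' : ℝ → ℝ) (ε₁' ε₂' : ℝ)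
    (σ lam : ℝ → ℝ) (μ : ℝ) : Prop where
  frenet_fst : FrenetApparatus α T N B κ τ ε₁ ε₂
  frenet_snd : FrenetApparatus β T' N' B' κ' τ' ε₁' ε₂'
  smooth_repar : ContDiff ℝ (⊤ : ℕ∞) σ
  surj_repar : Function.Surjective σ
  deriv_repar_pos : ∀ s, 0 < deriv σ s
  smooth_lam : ContDiff ℝ (⊤ : ℕ∞) lam
  sign_mu : μ = 1 ∨ μ = -1
  mannheim_eq : ∀ s, α s = β (σ s) + lam (σ s) • B' (σ s)
  binormal_eq : ∀ s, B' (σ s) = μ • N s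

/-- The hyperbolic-angle hypothesis relating the frames of a non-null Mannheim pair. -/
def HypAngle (T B T' N' : ℝ → Fin 3 → ℝ) (σ φ : ℝ → ℝ) : Prop :=
  ContDiff ℝ (⊤ : ℕ∞) φ ∧
  (∀ s, T s = Real.cosh (φ s) • T' (σ s) + Real.sinh (φ s) • N' (σ s)) ∧
  (∀ s, B s = Real.sinh (φ s) • T' (σ s) + Real.cosh (φ s) • N' (σ s))

/-- The real-angle hypothesis (Case 3) relating the frames of a non-null Mannheim pair. -/
def RealAngle (T B T' N' : ℝ → Fin 3 → ℝ) (σ φ : ℝ → ℝ) : Prop :=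
  ContDiff ℝ (⊤ : ℕ∞) φ ∧
  (∀ s, T s = Real.cos (φ s) • T' (σ s) + Real.sin (φ s) • N' (σ s)) ∧
  (∀ s, B s = -Real.sin (φ s) • T' (σ s) + Real.cos (φ s) • N' (σ s))

/-- Coefficients along `t` and `n` are unique when `t`, `n`, `b` are pairwise Minkowski-orthogonal
with `t` and `n` non-null. -/
theorem coeff_eq_of_mink_orthogonal {t n b : Fin 3 → ℝ} {x y x' y' z' : ℝ}
    (htt : mink t t ≠ 0) (hnn : mink n n ≠ 0)
    (htn : mink t n = 0) (htb : mink t b = 0) (hnb : mink n b = 0)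
    (h : x • t + y • n = x' • t + y' • n + z' • b) : x = x' ∧ y = y' := by
  have h0 := congrFun h 0
  have h1 := congrFun h 1
  have h2 := congrFun h 2
  simp only [Pi.add_apply, Pi.smul_apply, smul_eq_mul] at h0 h1 h2
  unfold mink at *
  constructor
  · apply mul_right_cancel₀ htt
    linear_combination -(t 0) * h0 + t 1 * h1 + t 2 * h2 + (y' - y) * htn + z' * htb
  · apply mul_right_cancel₀ hnn
    linear_combination -(n 0) * h0 + n 1 * h1 + n 2 * h2 + (x' - x) * htn + z' * hnb

/-- The tangent of the first curve of a Mannheim pair, in the frame of the second. -/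
theorem MannheimPair.tangent_eq {α β T N B T' N' B' : ℝ → Fin 3 → ℝ}
    {κ τ κ' τ' σ lam : ℝ → ℝ} {ε₁ ε₂ ε₁' ε₂' μ : ℝ}
    (hpair : MannheimPair α β T N B κ τ ε₁ ε₂ T' N' B' κ' τ' ε₁' ε₂' σ lam μ) (s : ℝ) :
    T s = deriv σ s • T' (σ s) + (deriv σ s * lam (σ s) * ε₁' * τ' (σ s)) • N' (σ s)
      + (deriv σ s * deriv lam (σ s)) • B' (σ s) := by
  have hF := hpair.frenet_snd
  have hσ : HasDerivAt σ (deriv σ s) s :=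
    (hpair.smooth_repar.differentiable (by simp) s).hasDerivAt
  have hβ : HasDerivAt β (T' (σ s)) (σ s) :=
    hF.tangent (σ s) ▸ (hF.smooth_curve.differentiable (by simp) _).hasDerivAt
  have hB : HasDerivAt B' ((ε₁' * τ' (σ s)) • N' (σ s)) (σ s) :=
    hF.frenet_B (σ s) ▸ (hF.smooth_B.differentiable (by simp) _).hasDerivAt
  have hlam : HasDerivAt lam (deriv lam (σ s)) (σ s) :=
    (hpair.smooth_lam.differentiable (by simp) _).hasDerivAt
  have hα : α = (fun u => β u + lam u • B' u) ∘ σ := funext hpair.mannheim_eq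
  have hderiv := ((hβ.add (hlam.smul hB)).scomp s hσ).deriv
  rw [hpair.frenet_fst.tangent, hα]
  refine hderiv.trans ?_
  module

/-- Equation (3.4): `σ' = cosh φ` and `σ'·λ∘σ·ε̃₁·τ̃∘σ = sinh φ`. -/
theorem mannheim_deriv_repar_eq
    (α β T N B T' N' B' : ℝ → Fin 3 → ℝ) (κ τ κ' τ' σ lam φ : ℝ → ℝ)
    (ε₁ ε₂ ε₁' ε₂' μ : ℝ)
    (hpair : MannheimPair α β T N B κ τ ε₁ ε₂ T' N' B' κ' τ' ε₁' ε₂' σ lam μ)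
    (hangle : HypAngle T B T' N' σ φ) :
    ∀ s, deriv σ s = Real.cosh (φ s) ∧
      deriv σ s * lam (σ s) * ε₁' * τ' (σ s) = Real.sinh (φ s) := by
  intro s
  have hF := hpair.frenet_snd
  have htt : mink (T' (σ s)) (T' (σ s)) ≠ 0 := by
    rw [hF.inner_TT]; rcases hF.sign1 with h | h <;> simp [h]
  have hnn : mink (N' (σ s)) (N' (σ s)) ≠ 0 := by
    rw [hF.inner_NN]; rcases hF.sign2 with h | h <;> simp [h]
  have h := coeff_eq_of_mink_orthogonal htt hnn (hF.inner_TN _) (hF.inner_TB _) (hF.inner_NB _)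
    ((hangle.2.1 s).symm.trans (hpair.tangent_eq s))
  exact ⟨h.1.symm, h.2.symm⟩
end
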